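/- arXiv:2105.01947 — 4 statements merged into one kernel-verified Lean document; each statement's English description precedes it below -/
import Mathlib

section
/- Let φ : A → B be a homomorphism of commutative rings. Then φ is a flat epimorphism if and only if for every prime ideal p of A, either the ideal of B generated by φ(p) is all of B, or the induced map A_p → B_p is bijective, where B_p denotes the localization of B at the multiplicative set φ(A ∖ p). -/
open TensorProduct in
/-- A faithfully flat epimorphism of commutative rings is bijective. -/
theorem bijective_algebraMap_of_faithfullyFlat_of_isEpi (R S : Type*) [CommRing R] [CommRing S]
    [Algebra R S] [Module.FaithfullyFlat R S] [Algebra.IsEpi R S] :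
    Function.Bijective (algebraMap R S) := by
  refine ⟨FaithfulSMul.algebraMap_injective R S,
    Module.FaithfullyFlat.surjective_of_tensorProduct (R := R) (S := S) fun x ↦ ?_⟩
  refine ⟨TensorProduct.lift (LinearMap.mul R S) x, Algebra.IsEpi.injective_lift_mul ?_⟩
  simp [Algebra.TensorProduct.algebraMap_apply]

/-- If `S` is flat over `R` and `p` is a prime of `R` with `pS ≠ S`, then `pS` does not meet the
image of the complement of `p`. -/
theorem disjoint_map_primeCompl_of_flat {R S : Type*} [CommRing R] [CommRing S] [Algebra R S]
    [Module.Flat R S] (p : Ideal R) [p.IsPrime] (hp : p.map (algebraMap R S) ≠ ⊤) :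
    Disjoint (p.primeCompl.map (algebraMap R S) : Set S) (p.map (algebraMap R S) : Set S) := by
  obtain ⟨Q, hQ, hpQ⟩ := Ideal.exists_le_maximal _ hp
  have : Q.IsPrime := hQ.isPrime
  obtain ⟨P, -, -, hP⟩ := Ideal.exists_ideal_le_liesOver_of_le (p := p) (q := Q.under R) Q
    (Ideal.map_le_iff_le_comap.mp hpQ)
  rw [Set.disjoint_left]
  rintro _ ⟨s, hs, rfl⟩ h
  refine hs ?_
  rw [hP.over]
  refine (Ideal.map_le_iff_le_comap.mpr ?_ : p.map (algebraMap R S) ≤ P) h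
  exact hP.over.le

section

universe u

variable {A B : Type*} [CommRing A] [CommRing B]

/-- The homomorphism `A_p → B_p` induced by `φ : A → B`, where `B_p` is the localization of `B` at
the image of the complement of `p`. -/
noncomputable abbrev localizationAtPrimeMap (φ : A →+* B) (p : Ideal A) [p.IsPrime] :
    Localization.AtPrime p →+* Localization (p.primeCompl.map φ) :=
  IsLocalization.map (M := p.primeCompl) (S := Localization.AtPrime p)
    (Localization (p.primeCompl.map φ)) φ (Submonoid.le_comap_map _)

theorem flat_localizationAtPrimeMap {φ : A →+* B} (hφ : φ.Flat) (p : Ideal A) [p.IsPrime] :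
    (localizationAtPrimeMap φ p).Flat := by
  algebraize [φ, localizationAtPrimeMap φ p]
  have : IsScalarTower A (Localization.AtPrime p) (Localization (p.primeCompl.map φ)) :=
    .of_algebraMap_eq fun x ↦ by
      rw [RingHom.algebraMap_toAlgebra, IsLocalization.map_eq,
        IsScalarTower.algebraMap_apply A B (Localization (p.primeCompl.map φ)),
        RingHom.algebraMap_toAlgebra φ]
  have : Module.Flat B (Localization (p.primeCompl.map φ)) :=
    IsLocalization.flat _ (p.primeCompl.map φ)
  rw [RingHom.Flat, Module.flat_iff_of_isLocalization
    (S := Localization.AtPrime p) (p := p.primeCompl)]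
  exact Module.Flat.trans A B _

theorem faithfullyFlat_localizationAtPrimeMap {φ : A →+* B} (hφ : φ.Flat) (p : Ideal A)
    [p.IsPrime] (hp : p.map φ ≠ ⊤) : (localizationAtPrimeMap φ p).FaithfullyFlat := by
  have hflat := flat_localizationAtPrimeMap hφ p
  have hdisj : Disjoint (p.primeCompl.map φ : Set B) (p.map φ : Set B) := by
    algebraize [φ]
    exact disjoint_map_primeCompl_of_flat p hp
  algebraize [localizationAtPrimeMap φ p]
  refine ⟨fun m hm ↦ ?_⟩
  rw [Ideal.smul_top_eq_map, Ne, Submodule.restrictScalars_eq_top_iff,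
    IsLocalRing.eq_maximalIdeal hm, ← IsLocalization.AtPrime.map_eq_maximalIdeal p,
    Ideal.map_map, RingHom.algebraMap_toAlgebra, IsLocalization.map_comp, ← Ideal.map_map]
  exact (IsLocalization.map_algebraMap_ne_top_iff_disjoint (p.primeCompl.map φ) _ _).mpr hdisj

/-- If every prime `p` of `A` with `pB ≠ B` induces a bijection `A_p → B_p`, then `A → B` is
flat. -/
theorem flat_of_bijective_localizationAtPrimeMap {A B : Type u} [CommRing A] [CommRing B]
    {φ : A →+* B}
    (H : ∀ (p : Ideal A) [p.IsPrime], p.map φ ≠ ⊤ →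
      Function.Bijective (localizationAtPrimeMap φ p)) : φ.Flat := by
  refine RingHom.Flat.ofLocalizationPrime φ fun J hJ ↦ ?_
  let p := J.comap φ
  have hp : p.map φ ≠ ⊤ := fun h ↦ hJ.ne_top (top_le_iff.mp (h ▸ Ideal.map_comap_le))
  have hle : p.primeCompl.map φ ≤ J.primeCompl := by
    rintro _ ⟨s, hs, rfl⟩
    exact hs
  have hle' : p.primeCompl.map φ ≤ J.primeCompl.comap (RingHom.id B) := hle
  let ψ : Localization (p.primeCompl.map φ) →+* Localization.AtPrime J :=
    IsLocalization.map (M := p.primeCompl.map φ) (T := J.primeCompl) _ (RingHom.id B) hle'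
  have hψ : ψ.Flat := by
    let := ψ.toAlgebra
    have : IsScalarTower B (Localization (p.primeCompl.map φ)) (Localization.AtPrime J) :=
      .of_algebraMap_eq fun x ↦ (IsLocalization.map_eq hle' x).symm
    have := IsLocalization.isLocalization_of_submonoid_le
      (Localization (p.primeCompl.map φ)) (Localization.AtPrime J) _ _ hle
    exact IsLocalization.flat _ (J.primeCompl.map (algebraMap B _))
  have hcomp : Localization.localRingHom p J φ rfl = ψ.comp (localizationAtPrimeMap φ p) := by
    refine IsLocalization.ringHom_ext p.primeCompl (RingHom.ext fun x ↦ ?_)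
    simp [ψ, Localization.localRingHom_to_map, IsLocalization.map_eq hle']
  rw [hcomp]
  exact (RingHom.Flat.of_bijective (H p hp)).comp hψ

/-- If every prime `p` of `A` with `pB ≠ B` induces a surjection `A_p → B_p`, then `A → B` is an
epimorphism. -/
theorem eq_of_comp_eq_of_surjective_localizationAtPrimeMap {φ : A →+* B}
    (H : ∀ (p : Ideal A) [p.IsPrime], p.map φ ≠ ⊤ →
      Function.Surjective (localizationAtPrimeMap φ p))
    {C : Type*} [CommRing C] {g h : B →+* C} (hgh : g.comp φ = h.comp φ) : g = h := by
  ext b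
  by_contra hne
  have hcolon : (⊥ : Ideal C).colon {g b - h b} ≠ ⊤ := by
    simpa [Ideal.ne_top_iff_one, Submodule.mem_colon_singleton, sub_eq_zero] using hne
  obtain ⟨m, hm, hle⟩ := Ideal.exists_le_maximal _ hcolon
  have := hm.isPrime
  let p := (m.comap g).comap φ
  have hp : p.map φ ≠ ⊤ := fun h ↦
    (Ideal.IsPrime.comap g (K := m)).ne_top (top_le_iff.mp (h ▸ Ideal.map_comap_le))
  obtain ⟨x, hx⟩ := H p hp (algebraMap B _ b)
  obtain ⟨a, s, rfl⟩ := IsLocalization.exists_mk'_eq p.primeCompl x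
  rw [localizationAtPrimeMap, IsLocalization.map_mk', IsLocalization.mk'_eq_iff_eq_mul,
    ← map_mul, IsLocalization.eq_iff_exists (p.primeCompl.map φ)] at hx
  obtain ⟨⟨_, t, ht, rfl⟩, hx⟩ := hx
  have hg := congr(g $hx)
  have hh := congr(h $hx)
  have key (y : A) : h (φ y) = g (φ y) := (RingHom.congr_fun hgh y).symm
  simp only [map_mul, key] at hg hh
  have hmem : g (φ (t * s)) ∈ m := hle <| by
    rw [Submodule.mem_colon_singleton]
    simp only [smul_eq_mul, Ideal.mem_bot, map_mul]
    linear_combination hh - hg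
  exact (p.primeCompl.mul_mem ht s.2) hmem

end

/-- A ring homomorphism `φ : A → B` is a flat epimorphism if and only if for every prime
ideal `p` of `A`, either the ideal of `B` generated by `φ(p)` is all of `B`, or the induced
map `A_p → B_p` is bijective, where `B_p` is the localization of `B` at the multiplicative
set `φ(A ∖ p)`. -/
theorem stmt1 {A B : Type} [CommRing A] [CommRing B] (φ : A →+* B) :
    (φ.Flat ∧
        ∀ (C : Type) [CommRing C] (g h : B →+* C), g.comp φ = h.comp φ → g = h) ↔
      ∀ (p : Ideal A) (_ : p.IsPrime),
        Ideal.map φ p = ⊤ ∨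
          Function.Bijective
            (IsLocalization.map (M := p.primeCompl) (S := Localization.AtPrime p)
              (Localization (p.primeCompl.map φ)) φ (Submonoid.le_comap_map _)) := by
  constructor
  · rintro ⟨hflat, hepi⟩ p _
    refine or_iff_not_imp_left.mpr fun hp ↦ ?_
    have hff := faithfullyFlat_localizationAtPrimeMap hflat p hp
    have hcancel : CategoryTheory.Epi (CommRingCat.ofHom (localizationAtPrimeMap φ p)) := by
      refine ⟨fun {C} g h hgh ↦ CommRingCat.hom_ext ?_⟩
      refine IsLocalization.ringHom_ext (p.primeCompl.map φ) (hepi C _ _ ?_)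
      have := congr(($hgh).hom.comp (algebraMap A (Localization.AtPrime p)))
      simpa [RingHom.comp_assoc, IsLocalization.map_comp] using this
    algebraize [localizationAtPrimeMap φ p]
    have : Algebra.IsEpi (Localization.AtPrime p) (Localization (p.primeCompl.map φ)) :=
      CommRingCat.epi_iff_epi.mp hcancel
    exact bijective_algebraMap_of_faithfullyFlat_of_isEpi _ _
  · intro H
    have H' (p : Ideal A) [hp : p.IsPrime] (h : p.map φ ≠ ⊤) :
        Function.Bijective (localizationAtPrimeMap φ p) := (H p hp).resolve_left h
    exact ⟨flat_of_bijective_localizationAtPrimeMap H', fun C _ g h hgh ↦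
      eq_of_comp_eq_of_surjective_localizationAtPrimeMap (fun p _ hp ↦ (H' p hp).2) hgh⟩
end

section
/- A homomorphism of commutative rings φ : A → B is étale if and only if it is flat, of finite presentation, and pointwise-étale, i.e., for every prime ideal p of A the fiber ring B ⊗_A κ(p) is an étale κ(p)-algebra. -/
open scoped TensorProduct

/-- A module over an `A`-algebra `B` that is finite over `B` vanishes as soon as its fibers over
all primes of `A` vanish. -/
theorem Module.subsingleton_of_forall_residueField_tensorProduct
    {A B M : Type*} [CommRing A] [CommRing B] [Algebra A B] [AddCommGroup M] [Module A M]
    [Module B M] [IsScalarTower A B M] [Module.Finite B M]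
    (h : ∀ (p : Ideal A) [p.IsPrime], Subsingleton (p.ResidueField ⊗[A] M)) :
    Subsingleton M := by
  rw [← Module.support_eq_empty_iff (R := B), Set.eq_empty_iff_forall_notMem]
  intro q hq
  rw [Module.mem_support_iff_nontrivial_residueField_tensorProduct] at hq
  let p : Ideal A := q.asIdeal.under A
  have : q.asIdeal.LiesOver p := ⟨rfl⟩
  let := Localization.AtPrime.algebraOfLiesOver p q.asIdeal
  have := h p
  have : Subsingleton (q.asIdeal.ResidueField ⊗[A] M) :=
    (TensorProduct.AlgebraTensorModule.cancelBaseChange A p.ResidueField p.ResidueField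
      q.asIdeal.ResidueField M).symm.subsingleton
  have : Subsingleton (q.asIdeal.ResidueField ⊗[B] M) :=
    (TensorProduct.mapOfCompatibleSMul_surjective B A A
      q.asIdeal.ResidueField M).subsingleton
  exact not_subsingleton _ this

/-- An algebra of finite type is unramified if its fibers are. -/
theorem Algebra.FormallyUnramified.of_forall_fiber {A B : Type*} [CommRing A] [CommRing B]
    [Algebra A B] [Algebra.FiniteType A B]
    (h : ∀ (p : Ideal A) [p.IsPrime], Algebra.FormallyUnramified p.ResidueField (p.Fiber B)) :
    Algebra.FormallyUnramified A B where
  subsingleton_kaehlerDifferential :=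
    Module.subsingleton_of_forall_residueField_tensorProduct (A := A) (B := B) fun p _ ↦ by
      have := h p
      let : Algebra B (p.Fiber B) := Algebra.TensorProduct.rightAlgebra
      exact (KaehlerDifferential.tensorKaehlerEquivBase A p.ResidueField B
        (p.Fiber B)).subsingleton

/-- An algebra `B` over `A` is étale if and only if it is flat, of finite presentation,
and pointwise étale: for every prime ideal `p` of `A` the fiber ring `B ⊗_A κ(p)` is an
étale `κ(p)`-algebra, where `κ(p)` is the residue field of the localization of `A` at
`p`. -/
theorem stmt4 {A B : Type} [CommRing A] [CommRing B] [Algebra A B] :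
    Algebra.Etale A B ↔
      Module.Flat A B ∧ Algebra.FinitePresentation A B ∧
        ∀ (p : Ideal A) (_ : p.IsPrime),
          Algebra.Etale (IsLocalRing.ResidueField (Localization.AtPrime p))
            (IsLocalRing.ResidueField (Localization.AtPrime p) ⊗[A] B) := by
  constructor
  · intro _
    exact ⟨inferInstance, inferInstance, fun p _ ↦ inferInstance⟩
  · rintro ⟨_, _, h⟩
    have : Algebra.FormallyUnramified A B := .of_forall_fiber fun p hp ↦
      have := h p hp
      inferInstanceAs (Algebra.FormallyUnramified p.ResidueField (p.ResidueField ⊗[A] B))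
    exact .of_formallyUnramified_of_flat
end

section
/- Let A be a Noetherian commutative ring, B a finite étale A-algebra, and G a finite group acting on B by A-algebra automorphisms. Then the invariant subalgebra B^G is again a finite étale A-algebra. -/
/-- The subalgebra of invariants of an action of a group `G` on an `A`-algebra `B` by
`A`-algebra automorphisms, the action being given by `ρ : G →* (B ≃ₐ[A] B)`. -/
def fixedSubalgebra {A B G : Type} [CommRing A] [CommRing B] [Algebra A B] [Group G]
    (ρ : G →* (B ≃ₐ[A] B)) : Subalgebra A B where
  carrier := {b | ∀ g : G, ρ g b = b}
  mul_mem' := by intro a b ha hb g; rw [map_mul, ha g, hb g]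
  one_mem' := by intro g; rw [map_one]
  add_mem' := by intro a b ha hb g; rw [map_add, ha g, hb g]
  zero_mem' := by intro g; rw [map_zero]
  algebraMap_mem' := by intro r g; exact (ρ g).commutes r

universe u

/-- Over a local ring, an algebra map out of a finite power of the base ring is a coordinate
projection. -/
lemma AlgHom.exists_eq_apply_of_isLocalRing {R ι : Type*} [CommRing R] [IsLocalRing R]
    [_root_.Finite ι] (φ : (ι → R) →ₐ[R] R) : ∃ j, ∀ f, φ f = f j := by
  classical
  cases nonempty_fintype ι
  have hsum : ∑ i, φ (Pi.single i 1) = 1 := by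
    rw [← map_sum]
    exact (congrArg φ (Finset.univ_sum_single (1 : ι → R))).trans (map_one φ)
  obtain ⟨j, -, hj⟩ := IsLocalRing.exists_of_isUnit_sum (hsum ▸ isUnit_one)
  have hj1 : φ (Pi.single j 1) = 1 := by
    apply hj.mul_left_cancel
    rw [← map_mul, ← Pi.single_mul, mul_one, mul_one]
  refine ⟨j, fun f ↦ ?_⟩
  have h : f * Pi.single j 1 = f j • Pi.single j 1 := by
    ext i
    obtain rfl | h := eq_or_ne i j <;> simp [*]
  have := congrArg φ h
  rwa [map_mul, hj1, mul_one, map_smul, hj1, smul_eq_mul, mul_one] at this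

namespace Algebra.IsFiniteSplit

/-- Over a local ring, the equalizer of two maps between finite split algebras is finite split. -/
lemma equalizer {R S C : Type*} [CommRing R] [IsLocalRing R] [CommRing S] [Algebra R S]
    [CommRing C] [Algebra R C] [IsFiniteSplit R S] [IsFiniteSplit R C] (f g : S →ₐ[R] C) :
    IsFiniteSplit R (AlgHom.equalizer f g) := by
  obtain ⟨n, ⟨e⟩⟩ := nonempty_algEquiv_fun R S
  obtain ⟨m, ⟨c⟩⟩ := nonempty_algEquiv_fun R C
  have key (h : S →ₐ[R] C) : ∃ a : Fin m → Fin n, ∀ x k, c (h x) k = e x (a k) := by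
    choose a ha using fun k : Fin m ↦ AlgHom.exists_eq_apply_of_isLocalRing
      (((Pi.evalAlgHom R (fun _ ↦ R) k).comp (c : C →ₐ[R] Fin m → R)).comp
        (h.comp (e.symm : (Fin n → R) →ₐ[R] S)))
    exact ⟨a, fun x k ↦ by simpa using ha k (e x)⟩
  obtain ⟨a, ha⟩ := key f
  obtain ⟨b, hb⟩ := key g
  let r : Fin n → Fin n → Prop := fun i j ↦ ∃ k, a k = i ∧ b k = j
  have mem (x : S) : x ∈ AlgHom.equalizer f g ↔ ∀ k, e x (a k) = e x (b k) := by
    rw [AlgHom.mem_equalizer, ← c.injective.eq_iff, funext_iff]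
    simp only [ha, hb]
  let F : (Quot r → R) →ₐ[R] AlgHom.equalizer f g :=
    ((e.symm : (Fin n → R) →ₐ[R] S).comp
      (AlgHom.pi fun i ↦ Pi.evalAlgHom R (fun _ ↦ R) (Quot.mk r i))).codRestrict _ fun y ↦ by
        rw [mem]
        intro k
        simpa using congrArg y (Quot.sound (r := r) ⟨k, rfl, rfl⟩)
  have hF (y : Quot r → R) (i : Fin n) : e (F y : S) i = y (Quot.mk r i) := by simp [F]
  refine .of_algEquiv (AlgEquiv.ofBijective F ⟨fun y z h ↦ ?_, fun x ↦ ?_⟩)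
  · ext q
    induction q using Quot.ind with
    | mk i => rw [← hF y i, ← hF z i, h]
  · refine ⟨Quot.lift (e x) ?_, ?_⟩
    · rintro _ _ ⟨k, rfl, rfl⟩
      exact (mem x).1 x.2 k
    · apply Subtype.ext
      apply e.injective
      ext i
      exact hF _ i

open _root_.TensorProduct in
/-- A finite étale algebra over a local ring is split by a faithfully flat local extension. -/
lemma exists_isLocalRing_tensorProduct_of_etale {R S : Type u} [CommRing R] [IsLocalRing R]
    [CommRing S] [Algebra R S] [Etale R S] [Module.Finite R S] :
    ∃ (T : Type u) (_ : CommRing T) (_ : Algebra R T) (_ : Module.FaithfullyFlat R T)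
      (_ : IsLocalRing T), IsFiniteSplit T (T ⊗[R] S) := by
  have : Module.Free R S := Module.free_of_flat_of_isLocalRing
  obtain ⟨T, _, _, _, _, _, _⟩ := exists_tensorProduct_of_etale (R := R) (S := S)
    Module.rankAtStalk_eq_finrank_of_free
  obtain ⟨q, hq⟩ := PrimeSpectrum.comap_surjective_of_faithfullyFlat (A := R) (B := T)
    (IsLocalRing.closedPoint R)
  let T' := Localization.AtPrime q.asIdeal
  have : IsLocalHom (algebraMap R T') := by
    rw [((IsLocalRing.local_hom_TFAE (algebraMap R T')).out 0 4 :)]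
    rw [IsScalarTower.algebraMap_eq R T T', ← Ideal.comap_comap]
    exact (congrArg (Ideal.comap (algebraMap R T))
      (Localization.AtPrime.under_maximalIdeal (I := q.asIdeal))).trans
        (congrArg PrimeSpectrum.asIdeal hq)
  exact ⟨T', inferInstance, inferInstance, .of_flat_of_isLocalHom, inferInstance,
    .of_algEquiv (TensorProduct.cancelBaseChange R T T' T' S)⟩

end Algebra.IsFiniteSplit

namespace Algebra

open _root_.TensorProduct

variable {R S C : Type u} [CommRing R] [CommRing S] [Algebra R S] [CommRing C] [Algebra R C]

lemma Etale.equalizer_of_isLocalRing_of_isFiniteSplit [IsLocalRing R] [IsFiniteSplit R S]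
    [Etale R C] [Module.Finite R C] (f g : S →ₐ[R] C) : Etale R (AlgHom.equalizer f g) := by
  obtain ⟨T, _, _, _, _, _⟩ :=
    IsFiniteSplit.exists_isLocalRing_tensorProduct_of_etale (R := R) (S := C)
  have := IsFiniteSplit.equalizer (TensorProduct.map (AlgHom.id T T) f)
    (TensorProduct.map (AlgHom.id T T) g)
  have : Etale T (T ⊗[R] AlgHom.equalizer f g) :=
    .of_equiv (AlgHom.tensorEqualizerEquiv T T f g).symm
  exact .of_etale_tensorProduct_of_faithfullyFlat T

lemma Etale.equalizer_of_isLocalRing [IsLocalRing R] [Etale R S] [Module.Finite R S]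
    [Etale R C] [Module.Finite R C] (f g : S →ₐ[R] C) : Etale R (AlgHom.equalizer f g) := by
  obtain ⟨T, _, _, _, _, _⟩ :=
    IsFiniteSplit.exists_isLocalRing_tensorProduct_of_etale (R := R) (S := S)
  have := equalizer_of_isLocalRing_of_isFiniteSplit (TensorProduct.map (AlgHom.id T T) f)
    (TensorProduct.map (AlgHom.id T T) g)
  have : Etale T (T ⊗[R] AlgHom.equalizer f g) :=
    .of_equiv (AlgHom.tensorEqualizerEquiv T T f g).symm
  exact .of_etale_tensorProduct_of_faithfullyFlat T

/-- An algebra is formally étale if its base changes to the local rings at all maximal ideals are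
formally étale. -/
lemma FormallyEtale.of_localization_maximal
    (h : ∀ (p : Ideal R) [p.IsMaximal],
      FormallyEtale (Localization.AtPrime p) (Localization.AtPrime p ⊗[R] S)) :
    FormallyEtale R S := by
  refine ⟨?_, ?_⟩
  · refine Module.subsingleton_of_localization_maximal (R := R)
      (fun p _ ↦ Localization.AtPrime p ⊗[R] Ω[S⁄R])
      (fun p _ ↦ TensorProduct.mk R (Localization.AtPrime p) _ 1) fun p _ ↦ ?_
    let _ : Algebra S (Localization.AtPrime p ⊗[R] S) := TensorProduct.rightAlgebra
    have := h p
    exact (KaehlerDifferential.tensorKaehlerEquivBase R (Localization.AtPrime p) S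
      (Localization.AtPrime p ⊗[R] S)).subsingleton
  · refine Module.subsingleton_of_localization_maximal (R := R)
      (fun p _ ↦ Localization.AtPrime p ⊗[R] H1Cotangent R S)
      (fun p _ ↦ TensorProduct.mk R (Localization.AtPrime p) _ 1) fun p _ ↦ ?_
    have := h p
    exact (tensorH1CotangentOfFlat R S (Localization.AtPrime p)).subsingleton

/-- The equalizer of two maps between finite étale algebras over a Noetherian ring is étale. -/
lemma Etale.equalizer [IsNoetherianRing R] [Etale R S] [Module.Finite R S]
    [Etale R C] [Module.Finite R C] (f g : S →ₐ[R] C) : Etale R (AlgHom.equalizer f g) := by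
  have : Module.Finite R (AlgHom.equalizer f g) :=
    .of_injective (AlgHom.equalizer f g).val.toLinearMap Subtype.val_injective
  refine ⟨.of_localization_maximal fun p _ ↦ ?_, .of_finiteType.1 inferInstance⟩
  let T := Localization.AtPrime p
  have := equalizer_of_isLocalRing (TensorProduct.map (AlgHom.id T T) f)
    (TensorProduct.map (AlgHom.id T T) g)
  exact .of_equiv (AlgHom.tensorEqualizerEquiv T T f g).symm

end Algebra

lemma fixedSubalgebra_eq_equalizer {A B G : Type} [CommRing A] [CommRing B] [Algebra A B]
    [Group G] (ρ : G →* (B ≃ₐ[A] B)) :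
    fixedSubalgebra ρ = AlgHom.equalizer (AlgHom.pi fun g ↦ (ρ g : B →ₐ[A] B))
      (AlgHom.pi fun _ : G ↦ AlgHom.id A B) := by
  ext b
  exact funext_iff.symm

/-- If `A` is a Noetherian commutative ring, `B` a finite étale `A`-algebra and `G` a
finite group acting on `B` by `A`-algebra automorphisms, then the invariant subalgebra
`B^G` is again a finite étale `A`-algebra. -/
theorem stmt15 {A B G : Type} [CommRing A] [IsNoetherianRing A] [CommRing B] [Algebra A B]
    [Group G] [Finite G] (ρ : G →* (B ≃ₐ[A] B))
    (het : Algebra.Etale A B) (hfin : Module.Finite A B) :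
    Algebra.Etale A (fixedSubalgebra ρ) ∧ Module.Finite A (fixedSubalgebra ρ) := by
  refine ⟨?_, .of_injective (fixedSubalgebra ρ).val.toLinearMap Subtype.val_injective⟩
  rw [fixedSubalgebra_eq_equalizer]
  exact .equalizer _ _
end

section
/- Let R be a nonzero Noetherian commutative ring whose prime spectrum is connected, and let A be a finite étale R-algebra. Then there exist a natural number n and a nonzero R-algebra B that is finitely generated as an R-module and faithfully flat over R, together with an isomorphism of B-algebras A ⊗_R B ≅ B^n (the product of n copies of B). -/
open scoped TensorProduct

/-- Let `R` be a nonzero Noetherian commutative ring with connected prime spectrum and `A`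
a finite étale `R`-algebra.  Then there exist `n : ℕ` and a nonzero `R`-algebra `B`,
finitely generated as an `R`-module and faithfully flat over `R`, such that
`A ⊗_R B ≅ B^n` as `B`-algebras. -/
theorem stmt16 {R A : Type} [CommRing R] [Nontrivial R] [IsNoetherianRing R]
    [ConnectedSpace (PrimeSpectrum R)] [CommRing A] [Algebra R A]
    (het : Algebra.Etale R A) (hfin : Module.Finite R A) :
    ∃ (n : ℕ) (B : Type) (_ : CommRing B) (_ : Algebra R B),
      Nontrivial B ∧ Module.Finite R B ∧ Module.FaithfullyFlat R B ∧
        Nonempty ((B ⊗[R] A) ≃ₐ[B] (Fin n → B)) := by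
  have : Module.FinitePresentation R A := Module.finitePresentation_of_finite R A
  obtain ⟨p⟩ : Nonempty (PrimeSpectrum R) := inferInstance
  have hn : Module.rankAtStalk (R := R) A = (Module.rankAtStalk (R := R) A p : ℕ) :=
    funext fun q ↦ Module.isLocallyConstant_rankAtStalk.apply_eq_of_preconnectedSpace q p
  obtain ⟨B, _, _, _, _, _, hsplit⟩ := Algebra.IsFiniteSplit.exists_tensorProduct_of_etale hn
  obtain ⟨n, e⟩ := hsplit.nonempty_algEquiv_fun
  exact ⟨n, B, inferInstance, inferInstance, (FaithfulSMul.algebraMap_injective R B).nontrivial,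
    inferInstance, inferInstance, e⟩
end
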